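/- arXiv:2305.17222 — 2 statements merged into one kernel-verified Lean document; each statement's English description precedes it below -/
import Mathlib

section
/- Let d̂ be reported demands where every user k ≠ 1 is truthful (d̂_k^t = d_k^t for all t). Fix a horizon T and a quantum T₀ ≤ T such that d̂_1^{T₀} > d_1^{T₀} (user 1 over-reports at T₀) and d̂_1^t ≤ d_1^t for all t with T₀ < t ≤ T (user 1 does not over-report after T₀). Define reported demands d̄ equal to d̂ everywhere except d̄_1^{T₀} = d_1^{T₀}. Then user 1's total useful allocation does not decrease when the over-report at T₀ is replaced by the truth: Û_1^T ≤ Ū_1^T, where Û and Ū denote total useful allocations under the Karma allocations for d̂ and d̄ respectively (both runs starting from zero cumulative allocations). -/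
open Finset

/-- One step of the Karma algorithm with instantaneous guarantee `α = 0`
(assuming no user runs out of credits): from prior cumulative allocations `R`
and reported demands `d`, each user `k` is allocated
`r k = min (d k) ((lam - R k)⁺)`, where the water level `lam ≥ 0` is such that
`∑ k, r k = min C (∑ k, d k)`. -/
def KarmaStep (n : ℕ) (C : ℝ) (R d r : Fin n → ℝ) : Prop :=
  ∃ lam : ℝ, 0 ≤ lam ∧ (∀ k, r k = min (d k) (max (lam - R k) 0)) ∧
    (∑ k, r k) = min C (∑ k, d k)

/-- Cumulative allocation of user `k` before quantum `t` (quanta are 0-based):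
`cum n r t k = ∑_{τ < t} r τ k`. -/
def cum (n : ℕ) (r : ℕ → Fin n → ℝ) (t : ℕ) (k : Fin n) : ℝ :=
  ∑ τ ∈ Finset.range t, r τ k

/-- A run of the Karma algorithm over quanta `0, 1, 2, …` with reported
demands `d t` and allocations `r t`, starting from zero cumulative
allocations. -/
def KarmaRun (n : ℕ) (C : ℝ) (d r : ℕ → Fin n → ℝ) : Prop :=
  ∀ t, KarmaStep n C (cum n r t) (d t) (r t)

/-- For a fixed demand and ordered water levels, the positive part of the gap between two
cumulative allocations does not grow in a Karma step. -/
lemma max_gap_add_min_le {a b d l m : ℝ} (hd : 0 ≤ d) (hlm : l ≤ m) :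
    max ((a + min d (max (l - a) 0)) - (b + min d (max (m - b) 0))) 0 ≤ max (a - b) 0 := by
  grind

/-- Two Karma steps with the same demands do not increase the total positive gap between the
cumulative allocations. -/
lemma KarmaStep.sum_max_gap_le {n : ℕ} {C : ℝ} {R R' d r r' : Fin n → ℝ} (hd : ∀ k, 0 ≤ d k)
    (h : KarmaStep n C R d r) (h' : KarmaStep n C R' d r') :
    ∑ k, max ((R k + r k) - (R' k + r' k)) 0 ≤ ∑ k, max (R k - R' k) 0 := by
  obtain ⟨l, -, hr, hs⟩ := h
  obtain ⟨m, -, hr', hs'⟩ := h'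
  rcases le_total l m with hlm | hml
  · refine Finset.sum_le_sum fun k _ => ?_
    rw [hr, hr']
    exact max_gap_add_min_le (hd k) hlm
  · have hneg : ∑ k, max ((R' k + r' k) - (R k + r k)) 0 ≤ ∑ k, max (R' k - R k) 0 := by
      refine Finset.sum_le_sum fun k _ => ?_
      rw [hr, hr']
      exact max_gap_add_min_le (hd k) hml
    have key : ∀ x y : Fin n → ℝ, ∑ k, max (x k - y k) 0 =
        ∑ k, max (y k - x k) 0 + (∑ k, x k - ∑ k, y k) := by
      intro x y
      rw [← Finset.sum_sub_distrib, ← Finset.sum_add_distrib]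
      refine Finset.sum_congr rfl fun k _ => ?_
      grind
    have h₁ := key (fun k => R k + r k) (fun k => R' k + r' k)
    have h₂ := key R R'
    simp only [Finset.sum_add_distrib] at h₁
    linarith

/-- Lowering one user's demand in a Karma step weakly raises all other allocations, weakly lowers
that user's allocation, and does not lower that user's allocation within the smaller demand. -/
lemma KarmaStep.lower_demand {n : ℕ} {C : ℝ} {R d d' r r' : Fin n → ℝ} {u : Fin n}
    (hu : d' u ≤ d u) (hne : ∀ k, k ≠ u → d' k = d k)
    (h : KarmaStep n C R d r) (h' : KarmaStep n C R d' r') :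
    (∀ k, k ≠ u → r k ≤ r' k) ∧ r' u ≤ r u ∧ min (r u) (d' u) ≤ r' u := by
  obtain ⟨l, -, hr, hs⟩ := h
  obtain ⟨m, -, hr', hs'⟩ := h'
  have hd : ∀ k, d' k ≤ d k := fun k => by
    by_cases hk : k = u
    · rwa [hk]
    · exact (hne k hk).le
  have hsum : ∑ k, r' k ≤ ∑ k, r k := by
    rw [hs, hs']
    exact min_le_min_left _ (Finset.sum_le_sum fun k _ => hd k)
  rcases le_total l m with hlm | hml
  · have hle : ∀ k, k ≠ u → r k ≤ r' k := fun k hk => by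
      rw [hr, hr', hne k hk]
      gcongr
    refine ⟨hle, ?_, ?_⟩
    · have herase : ∑ k ∈ Finset.univ.erase u, r k ≤ ∑ k ∈ Finset.univ.erase u, r' k :=
        Finset.sum_le_sum fun k hk => hle k (Finset.ne_of_mem_erase hk)
      have h₁ := Finset.add_sum_erase Finset.univ r (Finset.mem_univ u)
      have h₂ := Finset.add_sum_erase Finset.univ r' (Finset.mem_univ u)
      linarith
    · rw [hr, hr', min_comm]
      exact min_le_min_left _ ((min_le_right _ _).trans (by gcongr))
  · have hle : ∀ k, r' k ≤ r k := fun k => by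
      rw [hr, hr']
      exact min_le_min (hd k) (by gcongr)
    rcases le_total C (∑ k, d' k) with hC | hC
    · have hCd : C ≤ ∑ k, d k := hC.trans (Finset.sum_le_sum fun k _ => hd k)
      have heq : ∑ k, r' k = ∑ k, r k := by rw [hs, hs', min_eq_left hC, min_eq_left hCd]
      have hall := (Finset.sum_eq_sum_iff_of_le fun k _ => hle k).1 heq
      exact ⟨fun k _ => (hall k (Finset.mem_univ k)).ge, hle u,
        (min_le_left _ _).trans (hall u (Finset.mem_univ u)).ge⟩
    · have heq : ∑ k, r' k = ∑ k, d' k := by rw [hs', min_eq_right hC]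
      have hall := (Finset.sum_eq_sum_iff_of_le fun k _ =>
        (hr' k).trans_le (min_le_left _ _)).1 heq
      refine ⟨fun k hk => ?_, hle u, (min_le_right _ _).trans (hall u (Finset.mem_univ u)).ge⟩
      rw [hall k (Finset.mem_univ k), hne k hk, hr]
      exact min_le_left _ _

lemma cum_succ (n : ℕ) (r : ℕ → Fin n → ℝ) (t : ℕ) (k : Fin n) :
    cum n r (t + 1) k = cum n r t k + r t k :=
  Finset.sum_range_succ _ _

/-- While the reported demands of two Karma runs agree, the total positive gap between their
cumulative allocations does not grow. -/
lemma KarmaRun.sum_max_gap_le {n : ℕ} {C : ℝ} {d d' r r' : ℕ → Fin n → ℝ}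
    (h : KarmaRun n C d r) (h' : KarmaRun n C d' r') (hd : ∀ t k, 0 ≤ d t k) {s t : ℕ}
    (hst : s ≤ t) (heq : ∀ τ, s ≤ τ → τ < t → d' τ = d τ) :
    ∑ k, max (cum n r t k - cum n r' t k) 0 ≤ ∑ k, max (cum n r s k - cum n r' s k) 0 := by
  induction t, hst using Nat.le_induction with
  | base => exact le_rfl
  | succ t hst ih =>
    refine le_trans ?_ (ih fun τ h₁ h₂ => heq τ h₁ (by lia))
    simp only [cum_succ]
    have hstep := h' t
    rw [heq t hst (by lia)] at hstep
    exact (h t).sum_max_gap_le (hd t) hstep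

/-- As long as two Karma runs have the same reported demands, user `k`'s cumulative allocation in
the first does not exceed the one in the second. -/
lemma KarmaRun.cum_le_cum {n : ℕ} {C : ℝ} {d d' r r' : ℕ → Fin n → ℝ}
    (h : KarmaRun n C d r) (h' : KarmaRun n C d' r') (hd : ∀ t k, 0 ≤ d t k) {t : ℕ}
    (heq : ∀ τ, τ < t → d' τ = d τ) (k : Fin n) : cum n r t k ≤ cum n r' t k := by
  have hgap := h.sum_max_gap_le h' hd (Nat.zero_le t) fun τ _ hτ => heq τ hτ
  have hsingle := Finset.single_le_sum
    (f := fun k => max (cum n r t k - cum n r' t k) 0) (fun _ _ => le_max_right _ _)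
    (Finset.mem_univ k)
  simp only [cum, Finset.range_zero, Finset.sum_empty, sub_self, max_self,
    Finset.sum_const_zero] at hgap hsingle ⊢
  linarith [le_max_left (∑ τ ∈ Finset.range t, r τ k - ∑ τ ∈ Finset.range t, r' τ k) 0]

/-- Replacing a final over-report by the truth does not decrease user `u`'s
total useful allocation: suppose every user other than `u` reports truthfully
in `dh`, user `u` over-reports at quantum `T₀ < T` (`d T₀ u < dh T₀ u`) and
does not over-report at any quantum strictly between `T₀` and `T`. Let `dbar`
equal `dh` except that `dbar T₀ u = d T₀ u` (the true demand). Then user `u`'s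
total useful allocation up to `T` under `dh` is at most that under `dbar`
(both runs starting from zero cumulative allocations). -/
theorem karma_replace_overreport (n : ℕ) (C : ℝ) (hC : 0 < C) (u : Fin n)
    (d dh dbar rh rbar : ℕ → Fin n → ℝ)
    (hd : ∀ t k, 0 ≤ d t k) (hdh : ∀ t k, 0 ≤ dh t k)
    (hsame : ∀ t, ∀ k, k ≠ u → dh t k = d t k)
    (T T₀ : ℕ) (hT₀ : T₀ < T)
    (hover : d T₀ u < dh T₀ u)
    (hafter : ∀ t, T₀ < t → t < T → dh t u ≤ d t u)
    (hbar : ∀ t k, dbar t k = if t = T₀ ∧ k = u then d T₀ u else dh t k)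
    (hrunh : KarmaRun n C dh rh) (hrunbar : KarmaRun n C dbar rbar) :
    (∑ t ∈ Finset.range T, min (rh t u) (d t u)) ≤
      (∑ t ∈ Finset.range T, min (rbar t u) (d t u)) := by
  have hbar_ne : ∀ t, t ≠ T₀ → dbar t = dh t := fun t ht => by
    funext k
    rw [hbar, if_neg fun h => ht h.1]
  have hdbar : ∀ t k, 0 ≤ dbar t k := fun t k => by
    rw [hbar]
    split_ifs
    exacts [hd _ _, hdh _ _]
  have hcum : ∀ t, t ≤ T₀ → cum n rh t = cum n rbar t := fun t ht => by
    funext k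
    exact le_antisymm
      (hrunh.cum_le_cum hrunbar hdh (fun τ hτ => hbar_ne τ (by lia)) k)
      (hrunbar.cum_le_cum hrunh hdbar (fun τ hτ => (hbar_ne τ (by lia)).symm) k)
  have hbefore : ∀ t ∈ Finset.range T₀, min (rh t u) (d t u) = min (rbar t u) (d t u) := by
    intro t ht
    have ht := Finset.mem_range.1 ht
    have h₁ := congrFun (hcum (t + 1) ht) u
    rw [cum_succ, cum_succ, hcum t ht.le] at h₁
    rw [add_left_cancel h₁]
  have hstep := hrunbar T₀
  rw [← hcum T₀ le_rfl] at hstep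
  have hbar_u : dbar T₀ u = d T₀ u := by simp [hbar]
  obtain ⟨hothers, hmine, huseful⟩ := (hrunh T₀).lower_demand (u := u)
    (hbar_u.trans_le hover.le) (fun k hk => by simp [hbar, hk]) hstep
  rw [hbar_u] at huseful
  have hrbar_u : rbar T₀ u ≤ d T₀ u := by
    obtain ⟨m, -, hr, -⟩ := hstep
    rw [hr, hbar_u]
    exact min_le_left _ _
  have hgap₀ : ∑ k, max (cum n rh (T₀ + 1) k - cum n rbar (T₀ + 1) k) 0 =
      rh T₀ u - rbar T₀ u := by
    simp only [cum_succ, hcum T₀ le_rfl, add_sub_add_left_eq_sub]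
    rw [Finset.sum_eq_single_of_mem u (Finset.mem_univ u)
      fun k _ hk => max_eq_right (sub_nonpos.2 (hothers k hk))]
    exact max_eq_left (sub_nonneg.2 hmine)
  have hgap := hrunh.sum_max_gap_le hrunbar hdh (Nat.succ_le_of_lt hT₀)
    fun τ hτ _ => hbar_ne τ (by lia)
  have hsingle := Finset.single_le_sum
    (f := fun k => max (cum n rh T k - cum n rbar T k) 0) (fun _ _ => le_max_right _ _)
    (Finset.mem_univ u)
  have hT : cum n rh T u - cum n rbar T u ≤ rh T₀ u - rbar T₀ u :=
    (le_max_left _ 0).trans (hsingle.trans (hgap.trans hgap₀.le))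
  have hsplit : ∀ f : ℕ → ℝ, ∑ t ∈ Finset.range T, f t =
      ∑ t ∈ Finset.range T₀, f t + f T₀ + ∑ t ∈ Finset.Ico (T₀ + 1) T, f t := fun f => by
    rw [← Finset.sum_range_succ, Finset.sum_range_add_sum_Ico _ (Nat.succ_le_of_lt hT₀)]
  have hafter_h : ∀ t ∈ Finset.Ico (T₀ + 1) T, min (rh t u) (d t u) = rh t u := by
    intro t ht
    obtain ⟨h₁, h₂⟩ := Finset.mem_Ico.1 ht
    obtain ⟨m, -, hr, -⟩ := hrunh t
    exact min_eq_left (((hr u).trans_le (min_le_left _ _)).trans (hafter t h₁ h₂))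
  have hafter_bar : ∀ t ∈ Finset.Ico (T₀ + 1) T, min (rbar t u) (d t u) = rbar t u := by
    intro t ht
    obtain ⟨h₁, h₂⟩ := Finset.mem_Ico.1 ht
    obtain ⟨m, -, hr, -⟩ := hrunbar t
    rw [hbar_ne t (by lia)] at hr
    exact min_eq_left (((hr u).trans_le (min_le_left _ _)).trans (hafter t h₁ h₂))
  have hcum_u := congrFun (hcum T₀ le_rfl) u
  simp only [cum] at hT hcum_u
  rw [hsplit, hsplit fun t => rbar t u] at hT
  rw [hsplit, hsplit fun t => min (rbar t u) (d t u), Finset.sum_congr rfl hbefore,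
    Finset.sum_congr rfl hafter_h, Finset.sum_congr rfl hafter_bar, min_eq_left hrbar_u]
  linarith
end

section
/- Karma is online strategy-proof: suppose all users report their true demands during quanta 1, …, q−1 (so both runs have identical cumulative allocations R_k^{q−1} entering quantum q). If at quantum q user 1 reports an arbitrary demand d̂_1^q ≥ 0 while every other user reports truthfully, then user 1's useful allocation at quantum q does not exceed its truthful allocation: min(r̂_1^q, d_1^q) ≤ r_1^q, where r^q and r̂^q are the Karma step allocations at quantum q under truthful and deviating reports respectively. -/
open Finset

theorem KarmaStep.eq_of_lam_le {n : ℕ} {R d r r' : Fin n → ℝ} {lam lam' : ℝ}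
    (hle : lam ≤ lam') (hr : ∀ k, r k = min (d k) (max (lam - R k) 0))
    (hr' : ∀ k, r' k = min (d k) (max (lam' - R k) 0))
    (hsum : ∑ k, r k = ∑ k, r' k) : r = r' := by
  have hmono : ∀ k ∈ Finset.univ, r k ≤ r' k := by
    intro k _
    rw [hr, hr']
    gcongr
  funext k
  exact (Finset.sum_eq_sum_iff_of_le hmono).1 hsum k (Finset.mem_univ k)

theorem KarmaStep.unique {n : ℕ} {C : ℝ} {R d r r' : Fin n → ℝ}
    (h : KarmaStep n C R d r) (h' : KarmaStep n C R d r') : r = r' := by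
  obtain ⟨lam, -, hr, hs⟩ := h
  obtain ⟨lam', -, hr', hs'⟩ := h'
  rcases le_total lam lam' with hle | hle
  · exact KarmaStep.eq_of_lam_le hle hr hr' (hs.trans hs'.symm)
  · exact (KarmaStep.eq_of_lam_le hle hr' hr (hs'.trans hs.symm)).symm

theorem cum_congr {n : ℕ} {r r' : ℕ → Fin n → ℝ} {t : ℕ} (h : ∀ τ < t, r τ = r' τ) :
    cum n r t = cum n r' t := by
  funext k
  exact Finset.sum_congr rfl fun τ hτ => congrFun (h τ (Finset.mem_range.1 hτ)) k

theorem KarmaRun.eq_of_demands_eq {n : ℕ} {C : ℝ} {d d' r r' : ℕ → Fin n → ℝ} {q : ℕ}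
    (h : KarmaRun n C d r) (h' : KarmaRun n C d' r') (hd : ∀ t < q, d' t = d t) :
    ∀ t < q, r t = r' t := by
  intro t
  induction t using Nat.strong_induction_on with
  | _ t ih =>
    intro ht
    have hstep := h' t
    rw [hd t ht, ← cum_congr fun τ hτ => ih τ hτ (hτ.trans ht)] at hstep
    exact (h t).unique hstep

/-- A single Karma step is strategy-proof for user `u`. -/
theorem KarmaStep.min_le {n : ℕ} {C : ℝ} {R d d' r r' : Fin n → ℝ} {u : Fin n}
    (h : KarmaStep n C R d r) (h' : KarmaStep n C R d' r')
    (hd : ∀ k, k ≠ u → d' k = d k) : min (r' u) (d u) ≤ r u := by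
  obtain ⟨lam, -, hr, hs⟩ := h
  obtain ⟨lam', -, hr', hs'⟩ := h'
  by_contra! hlt
  obtain ⟨hru, hdu⟩ := lt_min_iff.1 hlt
  have hlevel : lam < lam' := by
    by_contra! hle
    have hmax : r u = max (lam - R u) 0 := by
      rcases min_choice (d u) (max (lam - R u) 0) with hc | hc
      · exact absurd ((hr u).trans hc) hdu.ne
      · exact (hr u).trans hc
    have hbound : r' u ≤ max (lam - R u) 0 := by
      rw [hr']
      exact (min_le_right _ _).trans (by gcongr)
    linarith
  have hlt_sum : ∑ k, r k < ∑ k, r' k := by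
    refine Finset.sum_lt_sum (fun k _ => ?_) ⟨u, Finset.mem_univ u, hru⟩
    by_cases hk : k = u
    · exact hk ▸ hru.le
    · rw [hr, hr', hd k hk]
      gcongr
  have hlt_demand : ∑ k, r k < ∑ k, d k :=
    Finset.sum_lt_sum (fun k _ => (hr k).trans_le (min_le_left _ _))
      ⟨u, Finset.mem_univ u, hdu⟩
  have hlt_cap : ∑ k, r k < C := hlt_sum.trans_le (hs'.trans_le (min_le_left _ _))
  exact (lt_min hlt_cap hlt_demand).ne hs

/-- (Online strategy-proofness.) Suppose all users report their true demands
during quanta `0, …, q - 1` (so the two runs have identical reported demands,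
and hence identical cumulative allocations, entering quantum `q`). If at
quantum `q` user `u` reports an arbitrary nonnegative demand `dh q u` while
every other user reports truthfully, then user `u`'s useful allocation at
quantum `q` does not exceed its truthful allocation at quantum `q`:
`min (rh q u) (d q u) ≤ r q u`. -/
theorem karma_online_strategy_proof (n : ℕ) (C : ℝ) (hC : 0 < C) (u : Fin n)
    (d dh r rh : ℕ → Fin n → ℝ)
    (hd : ∀ t k, 0 ≤ d t k) (hdh : ∀ t k, 0 ≤ dh t k)
    (q : ℕ)
    (hhist : ∀ t, t < q → ∀ k, dh t k = d t k)
    (hsame : ∀ k, k ≠ u → dh q k = d q k)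
    (hrun : KarmaRun n C d r) (hrunh : KarmaRun n C dh rh) :
    min (rh q u) (d q u) ≤ r q u := by
  have hstep := hrunh q
  rw [← cum_congr (hrun.eq_of_demands_eq hrunh fun t ht => funext (hhist t ht))] at hstep
  exact (hrun q).min_le hstep hsame
end
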